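/- Let (X,d_X) and (Y,d_Y) be bounded metric spaces, each with at least two points, let k > 0, and let T : LPM_k(X,d_X) → LPM_k(Y,d_Y) be a bijective sup-metric isometry satisfying T(Pp(X) ∩ LPM_k(X,d_X)) = Pp(Y) ∩ LPM_k(Y,d_Y). Then for all x, y ∈ X and every finite collection d_1, …, d_n ∈ Pp(X) ∩ LPM_k(X,d_X) with d_i(x,y) = ‖d_i‖ for each i, there exist points z, w ∈ Y such that T(d_i)(z,w) = ‖T(d_i)‖ for every i ∈ {1, …, n}. -/

import Mathlib

open Set Filter

namespace BanachStone

/-- `d` is a pseudometric. -/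
def IsPseudometric {Z : Type*} (d : Z → Z → ℝ) : Prop :=
  (∀ z, d z z = 0) ∧ (∀ z w, d z w = d w z) ∧ (∀ z w v, d z v ≤ d z w + d w v)

/-- `d` is bounded. -/
def IsBoundedPM {Z : Type*} (d : Z → Z → ℝ) : Prop := ∃ C : ℝ, ∀ z w, d z w ≤ C

/-- The sup-norm of `d`. -/
noncomputable def supNorm {Z : Type*} (d : Z → Z → ℝ) : ℝ := ⨆ p : Z × Z, d p.1 p.2

/-- The sup-metric between `d` and `ρ`. -/
noncomputable def supDist {Z : Type*} (d ρ : Z → Z → ℝ) : ℝ :=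
  ⨆ p : Z × Z, |d p.1 p.2 - ρ p.1 p.2|

/-- `PM Z`: bounded continuous pseudometrics on `Z`. -/
def PM (Z : Type*) [TopologicalSpace Z] : Set (Z → Z → ℝ) :=
  {d | IsPseudometric d ∧ IsBoundedPM d ∧ Continuous fun p : Z × Z => d p.1 p.2}

/-- The topology induced by `d` (generated by open `d`-balls). -/
def metricTopology {Z : Type*} (d : Z → Z → ℝ) : TopologicalSpace Z :=
  TopologicalSpace.generateFrom {s | ∃ z : Z, ∃ r : ℝ, s = {w | d z w < r}}

/-- `AM Z`: admissible metrics, i.e. bounded metrics inducing the topology of `Z`. -/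
def AM (Z : Type*) [t : TopologicalSpace Z] : Set (Z → Z → ℝ) :=
  {d | IsPseudometric d ∧ IsBoundedPM d ∧ (∀ z w : Z, z ≠ w → 0 < d z w) ∧
    metricTopology d = t}

/-- `Pp Z`: elements of `PM Z` attaining the sup-norm at exactly one unordered pair
of distinct points. -/
def Pp (Z : Type*) [TopologicalSpace Z] : Set (Z → Z → ℝ) :=
  {d | d ∈ PM Z ∧ ∃ z w : Z, z ≠ w ∧ d z w = supNorm d ∧
    ∀ z' w' : Z, z' ≠ w' → d z' w' = supNorm d → ({z', w'} : Set Z) = {z, w}}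

/-- `UPM Z`: bounded pseudometrics uniformly continuous w.r.t. the uniformity of `Z`. -/
def UPM (Z : Type*) [UniformSpace Z] : Set (Z → Z → ℝ) :=
  {d | IsPseudometric d ∧ IsBoundedPM d ∧
    ∀ ε : ℝ, 0 < ε → ∃ U ∈ uniformity Z, ∀ x y : Z, (x, y) ∈ U → d x y < ε}

/-- `UC Z`: bounded uniformly continuous real-valued functions on `Z`. -/
def UC (Z : Type*) [UniformSpace Z] : Set (Z → ℝ) :=
  {f | (∃ C : ℝ, ∀ z, |f z| ≤ C) ∧ UniformContinuous f}

/-- The space `U(Z)`. -/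
def Ucal (Z : Type*) [UniformSpace Z] : Set (Z → Z → ℝ) :=
  {d | d ∈ PM Z ∧ ∀ ε : ℝ, 0 < ε → ∃ F : Finset (Z → ℝ), F.Nonempty ∧
    (↑F : Set (Z → ℝ)) ⊆ UC Z ∧ ∃ δ : ℝ, 0 < δ ∧
    ∀ x y : Z, (∀ f ∈ F, |f x - f y| < δ) → d x y < ε}

/-- The uniformity filter of the coarsest uniformity on `Z` making every bounded
uniformly continuous real-valued function on `Z` uniformly continuous. -/
noncomputable def U0 (Z : Type*) [UniformSpace Z] : Filter (Z × Z) :=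
  ⨅ f ∈ UC Z, Filter.comap (fun p : Z × Z => (f p.1, f p.2)) (uniformity ℝ)

/-- The Lipschitz constant of a pseudometric on a metric space. -/
noncomputable def lip {Z : Type*} [PseudoMetricSpace Z] (d : Z → Z → ℝ) : ENNReal :=
  ⨆ (x : Z) (y : Z) (_ : x ≠ y), ENNReal.ofReal (d x y / dist x y)

/-- `LPM Z`: bounded Lipschitz continuous pseudometrics on `Z`. -/
def LPM (Z : Type*) [MetricSpace Z] : Set (Z → Z → ℝ) :=
  {d | IsPseudometric d ∧ IsBoundedPM d ∧ lip d < ⊤}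

/-- `LPM_k Z`: elements of `LPM Z` with Lipschitz constant `< k`. -/
def LPMlt (k : ℝ) (Z : Type*) [MetricSpace Z] : Set (Z → Z → ℝ) :=
  {d | d ∈ LPM Z ∧ lip d < ENNReal.ofReal k}

/-- `\overline{LPM}_k Z`: elements of `LPM Z` with Lipschitz constant `≤ k`. -/
def LPMle (k : ℝ) (Z : Type*) [MetricSpace Z] : Set (Z → Z → ℝ) :=
  {d | d ∈ LPM Z ∧ lip d ≤ ENNReal.ofReal k}

/-- `Z` has exactly two points. -/
def ExactlyTwo (Z : Type*) : Prop := ∃ a b : Z, a ≠ b ∧ ∀ c : Z, c = a ∨ c = b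

/-- The two-element subsets of `Z`. -/
def Dset (Z : Type*) : Set (Set Z) := {s | ∃ a b : Z, a ≠ b ∧ s = {a, b}}

/-- `c * d` for a pseudometric `d`. -/
def scale {Z : Type*} (c : ℝ) (d : Z → Z → ℝ) : Z → Z → ℝ := fun a b => c * d a b

/-- The pointwise maximum of two pseudometrics. -/
noncomputable def maxPM {Z : Type*} (d e : Z → Z → ℝ) : Z → Z → ℝ := fun a b => max (d a b) (e a b)

namespace IsPseudometric

variable {Z : Type*} {d e : Z → Z → ℝ}

theorem nonneg (h : IsPseudometric d) (a b : Z) : 0 ≤ d a b := by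
  have h1 := h.2.2 a b a
  rw [h.1 a, h.2.1 b a] at h1
  linarith

theorem scale (h : IsPseudometric d) {c : ℝ} (hc : 0 ≤ c) : IsPseudometric (scale c d) := by
  refine ⟨fun z => ?_, fun z w => ?_, fun z w v => ?_⟩
  · simp [BanachStone.scale, h.1 z]
  · simp [BanachStone.scale, h.2.1 z w]
  · simp only [BanachStone.scale, ← mul_add]
    exact mul_le_mul_of_nonneg_left (h.2.2 z w v) hc

theorem maxPM (hd : IsPseudometric d) (he : IsPseudometric e) : IsPseudometric (maxPM d e) := by
  refine ⟨fun z => ?_, fun z w => ?_, fun z w v => max_le ?_ ?_⟩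
  · simp [BanachStone.maxPM, hd.1 z, he.1 z]
  · simp [BanachStone.maxPM, hd.2.1 z w, he.2.1 z w]
  · exact (hd.2.2 z w v).trans (add_le_add (le_max_left _ _) (le_max_left _ _))
  · exact (he.2.2 z w v).trans (add_le_add (le_max_right _ _) (le_max_right _ _))

end IsPseudometric

section SupNorm

variable {Z : Type*} {d e : Z → Z → ℝ}

theorem le_supNorm (hb : IsBoundedPM d) (a b : Z) : d a b ≤ supNorm d := by
  obtain ⟨C, hC⟩ := hb
  exact le_ciSup (f := fun p : Z × Z => d p.1 p.2) ⟨C, by rintro _ ⟨p, rfl⟩; exact hC _ _⟩ (a, b)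

theorem supNorm_le [Nonempty Z] {C : ℝ} (h : ∀ a b, d a b ≤ C) : supNorm d ≤ C :=
  ciSup_le fun p => h p.1 p.2

theorem supDist_le [Nonempty Z] {C : ℝ} (h : ∀ a b, |d a b - e a b| ≤ C) : supDist d e ≤ C :=
  ciSup_le fun p => h p.1 p.2

theorem abs_sub_le_supDist (hd : IsPseudometric d) (he : IsPseudometric e)
    (hbd : IsBoundedPM d) (hbe : IsBoundedPM e) (a b : Z) : |d a b - e a b| ≤ supDist d e := by
  obtain ⟨C, hC⟩ := hbd
  obtain ⟨D, hD⟩ := hbe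
  refine le_ciSup (f := fun p : Z × Z => |d p.1 p.2 - e p.1 p.2|) ⟨C + D, ?_⟩ (a, b)
  rintro _ ⟨p, rfl⟩
  have h1 := hC p.1 p.2
  have h2 := hD p.1 p.2
  have h3 := hd.nonneg p.1 p.2
  have h4 := he.nonneg p.1 p.2
  exact abs_le.2 ⟨by linarith, by linarith⟩

theorem supDist_zero (hd : IsPseudometric d) : supDist d 0 = supNorm d := by
  simp only [supDist, supNorm, Pi.zero_apply, sub_zero, abs_of_nonneg (hd.nonneg _ _)]

theorem IsBoundedPM.scale (hb : IsBoundedPM d) {c : ℝ} (hc : 0 ≤ c) : IsBoundedPM (scale c d) :=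
  hb.imp' (c * ·) fun _ h z w => mul_le_mul_of_nonneg_left (h z w) hc

end SupNorm

section Lipschitz

variable {Z : Type*} [MetricSpace Z] {k : ℝ} {d e : Z → Z → ℝ}

theorem mem_LPMlt_iff (hk : 0 < k) : d ∈ LPMlt k Z ↔ IsPseudometric d ∧ IsBoundedPM d ∧
    ∃ c : ℝ, 0 ≤ c ∧ c < k ∧ ∀ a b, d a b ≤ c * dist a b := by
  constructor
  · rintro ⟨⟨hd, hb, hl⟩, hlk⟩
    refine ⟨hd, hb, (lip d).toReal, ENNReal.toReal_nonneg, ?_, fun a b => ?_⟩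
    · rwa [← ENNReal.ofReal_toReal hl.ne, ENNReal.ofReal_lt_ofReal_iff hk] at hlk
    · rcases eq_or_ne a b with rfl | hab
      · simp [hd.1 a]
      · rw [← div_le_iff₀ (dist_pos.2 hab), ← ENNReal.ofReal_le_iff_le_toReal hl.ne]
        exact le_iSup_of_le a (le_iSup_of_le b (le_iSup_of_le hab le_rfl))
  · rintro ⟨hd, hb, c, hc, hck, h⟩
    have hl : lip d ≤ ENNReal.ofReal c := by
      refine iSup_le fun a => iSup_le fun b => iSup_le fun hab => ENNReal.ofReal_le_ofReal ?_
      rw [div_le_iff₀ (dist_pos.2 hab)]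
      exact h a b
    exact ⟨⟨hd, hb, hl.trans_lt ENNReal.ofReal_lt_top⟩,
      hl.trans_lt ((ENNReal.ofReal_lt_ofReal_iff hk).2 hck)⟩

theorem zero_mem_LPMlt (hk : 0 < k) : (0 : Z → Z → ℝ) ∈ LPMlt k Z :=
  (mem_LPMlt_iff hk).2 ⟨⟨by simp, by simp, by simp⟩, ⟨0, by simp⟩, 0, le_rfl, hk, by simp⟩

theorem scale_mem_LPMlt (hk : 0 < k) (hd : IsPseudometric d) (hb : IsBoundedPM d) {c t : ℝ}
    (hc : 0 ≤ c) (hl : ∀ a b, d a b ≤ c * dist a b) (ht : 0 ≤ t) (htc : t * c < k) :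
    scale t d ∈ LPMlt k Z :=
  (mem_LPMlt_iff hk).2 ⟨hd.scale ht, hb.scale ht, t * c, by positivity, htc, fun a b => by
    rw [mul_assoc]
    exact mul_le_mul_of_nonneg_left (hl a b) ht⟩

theorem scale_mem_LPMlt_of_le_one (hk : 0 < k) (hd : d ∈ LPMlt k Z) {t : ℝ} (ht : 0 ≤ t)
    (ht1 : t ≤ 1) : scale t d ∈ LPMlt k Z := by
  obtain ⟨h1, h2, c, hc, hck, hl⟩ := (mem_LPMlt_iff hk).1 hd
  exact scale_mem_LPMlt hk h1 h2 hc hl ht ((mul_le_of_le_one_left hc ht1).trans_lt hck)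

theorem maxPM_mem_LPMlt (hk : 0 < k) (hd : d ∈ LPMlt k Z) (he : e ∈ LPMlt k Z) :
    maxPM d e ∈ LPMlt k Z := by
  obtain ⟨h1, ⟨C, hC⟩, c, hc, hck, hl⟩ := (mem_LPMlt_iff hk).1 hd
  obtain ⟨h1', ⟨C', hC'⟩, c', hc', hck', hl'⟩ := (mem_LPMlt_iff hk).1 he
  refine (mem_LPMlt_iff hk).2 ⟨h1.maxPM h1', ⟨max C C', fun z w => max_le_max (hC z w) (hC' z w)⟩,
    max c c', le_max_of_le_left hc, max_lt hck hck', fun a b => max_le ?_ ?_⟩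
  · exact (hl a b).trans (mul_le_mul_of_nonneg_right (le_max_left _ _) dist_nonneg)
  · exact (hl' a b).trans (mul_le_mul_of_nonneg_right (le_max_right _ _) dist_nonneg)

end Lipschitz

/-- If `d` and `e` are in `Pp Z` and attain their positive norms at a common pair, there is `f` in
`Pp Z` whose distances to `d` and `e` are the differences of the norms. -/
theorem exists_common_minorant {Z : Type*} [MetricSpace Z] [Nonempty Z] {k : ℝ} (hk : 0 < k)
    {d e : Z → Z → ℝ} (hd : d ∈ Pp Z ∩ LPMlt k Z) (he : e ∈ Pp Z ∩ LPMlt k Z) {x y : Z}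
    (hdxy : d x y = supNorm d) (hexy : e x y = supNorm e) (hd0 : 0 < supNorm d)
    (he0 : 0 < supNorm e) :
    ∃ f ∈ Pp Z ∩ LPMlt k Z, supDist d f ≤ supNorm d - supNorm f ∧
      supDist e f ≤ supNorm e - supNorm f := by
  obtain ⟨⟨⟨hdp, hdb, hdc⟩, z, w, -, -, hdu⟩, hdL⟩ := hd
  obtain ⟨⟨⟨hep, heb, hec⟩, z', w', -, -, heu⟩, heL⟩ := he
  have hxy : x ≠ y := by
    rintro rfl
    rw [hdp.1] at hdxy
    exact hd0.ne hdxy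
  set M := supNorm d
  set N := supNorm e
  obtain ⟨m, hm0, hmM, hmN⟩ : ∃ m : ℝ, 0 < m ∧ 2 * m ≤ M ∧ 2 * m ≤ N :=
    ⟨min M N / 2, by have := lt_min hd0 he0; linarith, by linarith [min_le_left M N],
      by linarith [min_le_right M N]⟩
  have hs0 : 0 < m / M := by positivity
  have ht0 : 0 < m / N := by positivity
  have hs1 : m / M ≤ 1 := (div_le_one hd0).2 (by linarith)
  have ht1 : m / N ≤ 1 := (div_le_one he0).2 (by linarith)
  have hsM : m / M * M = m := div_mul_cancel₀ _ hd0.ne'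
  have htN : m / N * N = m := div_mul_cancel₀ _ he0.ne'
  set s := m / M
  set t := m / N
  have hdle : ∀ a b, d a b ≤ M := le_supNorm hdb
  have hele : ∀ a b, e a b ≤ N := le_supNorm heb
  set f := maxPM (scale s d) (scale t e)
  have hfL : f ∈ LPMlt k Z := maxPM_mem_LPMlt hk (scale_mem_LPMlt_of_le_one hk hdL hs0.le hs1)
    (scale_mem_LPMlt_of_le_one hk heL ht0.le ht1)
  have hfp : IsPseudometric f := hfL.1.1
  have hfb : IsBoundedPM f := hfL.1.2.1
  have hfle : ∀ a b, f a b ≤ m := fun a b => max_le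
    ((mul_le_mul_of_nonneg_left (hdle a b) hs0.le).trans hsM.le)
    ((mul_le_mul_of_nonneg_left (hele a b) ht0.le).trans htN.le)
  have hfd : ∀ a b, s * d a b ≤ f a b := fun a b => le_max_left _ _
  have hfe : ∀ a b, t * e a b ≤ f a b := fun a b => le_max_right _ _
  have hfxy : f x y = m := le_antisymm (hfle x y) (by
    have := hfd x y
    rwa [hdxy, hsM] at this)
  have hfn : supNorm f = m := le_antisymm (supNorm_le hfle) (hfxy ▸ le_supNorm hfb x y)
  refine ⟨f, ⟨⟨⟨hfp, hfb, (hdc.const_mul s).max (hec.const_mul t)⟩, x, y, hxy, by rw [hfxy, hfn],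
    fun a b hab h => ?_⟩, hfL⟩, supDist_le fun a b => ?_, supDist_le fun a b => ?_⟩
  · rw [hfn] at h
    rcases max_choice (s * d a b) (t * e a b) with h' | h'
    · have h1 : s * d a b = s * M := by rw [hsM, ← h]; exact h'.symm
      rw [hdu a b hab (mul_left_cancel₀ hs0.ne' h1), hdu x y hxy hdxy]
    · have h1 : t * e a b = t * N := by rw [htN, ← h]; exact h'.symm
      rw [heu a b hab (mul_left_cancel₀ ht0.ne' h1), heu x y hxy hexy]
  · rw [hfn, abs_le]
    have h1 := hfle a b
    have h2 := hdp.nonneg a b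
    have h3 := hfd a b
    have h4 := mul_le_mul_of_nonneg_right hs1 (sub_nonneg.2 (hdle a b))
    exact ⟨by linarith, by linarith⟩
  · rw [hfn, abs_le]
    have h1 := hfle a b
    have h2 := hep.nonneg a b
    have h3 := hfe a b
    have h4 := mul_le_mul_of_nonneg_right ht1 (sub_nonneg.2 (hele a b))
    exact ⟨by linarith, by linarith⟩

/-- If the distance of `d` and `f` is the difference of their norms, then `f` attains its norm
wherever `d` does. -/
theorem eq_supNorm_of_supDist_le {Z : Type*} {d f : Z → Z → ℝ} (hd : IsPseudometric d)
    (hf : IsPseudometric f) (hdb : IsBoundedPM d) (hfb : IsBoundedPM f)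
    (h : supDist d f ≤ supNorm d - supNorm f) {z w : Z} (hzw : d z w = supNorm d) :
    f z w = supNorm f := by
  have h1 := (le_abs_self _).trans ((abs_sub_le_supDist hd hf hdb hfb z w).trans h)
  exact le_antisymm (le_supNorm hfb z w) (by linarith)

/-- A surjective isometry fixes `0`, the only point that is not strictly between two others. -/
theorem map_zero_of_isometry {X Y : Type*} [MetricSpace X] [MetricSpace Y] [Nonempty X]
    {k : ℝ} (hk : 0 < k) {T : (X → X → ℝ) → (Y → Y → ℝ)}
    (hbij : Set.BijOn T (LPMlt k X) (LPMlt k Y))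
    (hiso : ∀ d ∈ LPMlt k X, ∀ e ∈ LPMlt k X, supDist (T d) (T e) = supDist d e) :
    T 0 = 0 := by
  have h0 : (0 : X → X → ℝ) ∈ LPMlt k X := zero_mem_LPMlt hk
  obtain ⟨hr, hb, c, hc, hck, hl⟩ := (mem_LPMlt_iff hk).1 (hbij.mapsTo h0)
  set r := T 0
  by_contra hne
  obtain ⟨a, b, hab⟩ : ∃ a b, r a b ≠ 0 := by
    by_contra! h
    exact hne (funext fun a => funext fun b => h a b)
  have : Nonempty Y := ⟨a⟩
  have hN : 0 < supNorm r :=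
    (lt_of_le_of_ne (hr.nonneg a b) hab.symm).trans_le (le_supNorm hb a b)
  obtain ⟨t, ht0, ht1, htk⟩ : ∃ t : ℝ, 0 < t ∧ t ≤ 1 ∧ (1 + t) * c < k := by
    refine ⟨min 1 ((k - c) / (k + c)), lt_min one_pos (div_pos (by linarith) (by linarith)),
      min_le_left _ _, ?_⟩
    have h1 : min 1 ((k - c) / (k + c)) * (k + c) ≤ k - c :=
      (le_div_iff₀ (by linarith)).1 (min_le_right _ _)
    have h2 : 0 < min 1 ((k - c) / (k + c)) :=
      lt_min one_pos (div_pos (by linarith) (by linarith))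
    nlinarith
  have hp : scale (1 + t) r ∈ LPMlt k Y := scale_mem_LPMlt hk hr hb hc hl (by linarith) htk
  have hq : scale (1 - t) r ∈ LPMlt k Y :=
    scale_mem_LPMlt hk hr hb hc hl (by linarith) (by nlinarith)
  have hpr : supDist (scale (1 + t) r) r ≤ t * supNorm r := supDist_le fun u v => by
    have h1 := mul_nonneg ht0.le (hr.nonneg u v)
    have h2 := mul_le_mul_of_nonneg_left (le_supNorm hb u v) ht0.le
    exact abs_le.2 ⟨by simp only [scale]; linarith, by simp only [scale]; linarith⟩
  have hqr : supDist (scale (1 - t) r) r ≤ t * supNorm r := supDist_le fun u v => by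
    have h1 := mul_nonneg ht0.le (hr.nonneg u v)
    have h2 := mul_le_mul_of_nonneg_left (le_supNorm hb u v) ht0.le
    exact abs_le.2 ⟨by simp only [scale]; linarith, by simp only [scale]; linarith⟩
  have hpq : 2 * t * supNorm r ≤ supDist (scale (1 + t) r) (scale (1 - t) r) := by
    rw [mul_comm, ← le_div_iff₀ (by positivity)]
    refine supNorm_le fun u v => ?_
    rw [le_div_iff₀ (by positivity)]
    have := (le_abs_self _).trans
      (abs_sub_le_supDist hp.1.1 hq.1.1 hp.1.2.1 hq.1.2.1 u v)
    simp only [scale] at this ⊢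
    linarith
  obtain ⟨p, hpX, hTp⟩ := hbij.surjOn hp
  obtain ⟨q, hqX, hTq⟩ := hbij.surjOn hq
  rw [← hTp, ← hTq, hiso p hpX q hqX] at hpq
  rw [← hTp, hiso p hpX 0 h0, supDist_zero hpX.1.1] at hpr
  rw [← hTq, hiso q hqX 0 h0, supDist_zero hqX.1.1] at hqr
  have hle : supDist p q ≤ t * supNorm r := supDist_le fun u v => by
    have h1 := (le_supNorm hpX.1.2.1 u v).trans hpr
    have h2 := (le_supNorm hqX.1.2.1 u v).trans hqr
    have h3 := hpX.1.1.nonneg u v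
    have h4 := hqX.1.1.nonneg u v
    exact abs_le.2 ⟨by linarith, by linarith⟩
  have := mul_pos ht0 hN
  linarith

theorem stmt14 {X Y : Type*} [MetricSpace X] [MetricSpace Y]
    [Nontrivial X] [Nontrivial Y]
    (hX : ∃ C : ℝ, ∀ a b : X, dist a b ≤ C) (hY : ∃ C : ℝ, ∀ a b : Y, dist a b ≤ C)
    (k : ℝ) (hk : 0 < k)
    (T : (X → X → ℝ) → (Y → Y → ℝ))
    (hbij : Set.BijOn T (LPMlt k X) (LPMlt k Y))
    (hiso : ∀ d ∈ LPMlt k X, ∀ e ∈ LPMlt k X, supDist (T d) (T e) = supDist d e)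
    (hPp : T '' (Pp X ∩ LPMlt k X) = Pp Y ∩ LPMlt k Y) :
    ∀ x y : X, ∀ n : ℕ, ∀ d : Fin n → (X → X → ℝ),
      (∀ i, d i ∈ Pp X ∩ LPMlt k X) → (∀ i, d i x y = supNorm (d i)) →
      ∃ z w : Y, ∀ i, T (d i) z w = supNorm (T (d i)) := by
  intro x y n d hd hdxy
  have h0 : (0 : X → X → ℝ) ∈ LPMlt k X := zero_mem_LPMlt hk
  have hT0 : T 0 = 0 := map_zero_of_isometry hk hbij hiso
  have hnorm : ∀ e ∈ LPMlt k X, supNorm (T e) = supNorm e := fun e he => by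
    rw [← supDist_zero he.1.1, ← hiso e he 0 h0, hT0, supDist_zero (hbij.mapsTo he).1.1]
  have hTP : ∀ e ∈ Pp X ∩ LPMlt k X, T e ∈ Pp Y ∩ LPMlt k Y := fun e he =>
    hPp ▸ Set.mem_image_of_mem T he
  have hzero : ∀ i, supNorm (d i) ≤ 0 → ∀ z w, T (d i) z w = supNorm (T (d i)) := by
    intro i hi z w
    have hTi := (hTP _ (hd i)).2
    have h1 := le_supNorm hTi.1.2.1 z w
    have h2 := hTi.1.1.nonneg z w
    have h3 := hnorm _ (hd i).2
    linarith
  by_cases hall : ∀ i, supNorm (d i) ≤ 0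
  · obtain ⟨z⟩ := (inferInstance : Nonempty Y)
    exact ⟨z, z, fun i => hzero i (hall i) z z⟩
  push Not at hall
  obtain ⟨i, hi⟩ := hall
  obtain ⟨⟨-, z, w, hzw, hTi, -⟩, hTiL⟩ := hTP _ (hd i)
  refine ⟨z, w, fun j => ?_⟩
  rcases le_or_gt (supNorm (d j)) 0 with hj | hj
  · exact hzero j hj z w
  obtain ⟨⟨-, z', w', hzw', hTj, -⟩, hTjL⟩ := hTP _ (hd j)
  obtain ⟨f, hf, hfi, hfj⟩ := exists_common_minorant hk (hd i) (hd j) (hdxy i) (hdxy j) hi hj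
  obtain ⟨⟨-, u, v, -, -, huv⟩, hTfL⟩ := hTP f hf
  rw [← hiso _ (hd i).2 _ hf.2, ← hnorm _ (hd i).2, ← hnorm _ hf.2] at hfi
  rw [← hiso _ (hd j).2 _ hf.2, ← hnorm _ (hd j).2, ← hnorm _ hf.2] at hfj
  have hset : ({z, w} : Set Y) = {z', w'} :=
    (huv z w hzw (eq_supNorm_of_supDist_le hTiL.1.1 hTfL.1.1 hTiL.1.2.1 hTfL.1.2.1 hfi hTi)).trans
      (huv z' w' hzw'
        (eq_supNorm_of_supDist_le hTjL.1.1 hTfL.1.1 hTjL.1.2.1 hTfL.1.2.1 hfj hTj)).symm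
  rcases Set.pair_eq_pair_iff.1 hset with ⟨rfl, rfl⟩ | ⟨rfl, rfl⟩
  · exact hTj
  · rw [hTjL.1.1.2.1, hTj]

end BanachStone
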